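/- arXiv:2107.14189 — 3 statements merged into one kernel-verified Lean document; each statement's English description precedes it below -/
import Mathlib

section
/- Let k be a field and let σ be any k-algebra automorphism of the Laurent polynomial ring k[h^{±1}] and a ∈ k[h^{±1}]. Then the generalized Weyl algebra k[h^{±1}](σ,a) is isomorphic as a k-algebra to one, and only one, of the following three families: (1) k[h^{±1}](id, a') for some a' ∈ k[h^{±1}]; (2) k[h^{±1}](σ_q, a') where σ_q(h) = q h with q ∈ k^*, q ≠ 1; (3) k[h^{±1}](σ_inv, a') where σ_inv(h) = q h^{-1} with q ∈ k^*. That is, every k[h^{±1}](σ,a) is isomorphic to an algebra in one of the three families, and no algebra belonging to one family is isomorphic to an algebra belonging to a different family. -/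
open LaurentPolynomial

/-- The defining relations of the degree-one generalized Weyl algebra `k[h^{±1}](σ, a)`:
the generators `Sum.inl p` (for `p` a Laurent polynomial) give a copy of `k[h^{±1}]`,
and the generators `x = Sum.inr 0` and `y = Sum.inr 1` satisfy
`y x = a`, `x y = σ a`, `x r = σ(r) x` and `y r = σ⁻¹(r) y` for all `r ∈ k[h^{±1}]`. -/
inductive GWARel (k : Type*) [CommRing k] (σ : LaurentPolynomial k ≃ₐ[k] LaurentPolynomial k)
    (a : LaurentPolynomial k) :
    FreeAlgebra k (LaurentPolynomial k ⊕ Fin 2) →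
      FreeAlgebra k (LaurentPolynomial k ⊕ Fin 2) → Prop
  | add (r s : LaurentPolynomial k) :
      GWARel k σ a (FreeAlgebra.ι k (Sum.inl (r + s)))
        (FreeAlgebra.ι k (Sum.inl r) + FreeAlgebra.ι k (Sum.inl s))
  | mul (r s : LaurentPolynomial k) :
      GWARel k σ a (FreeAlgebra.ι k (Sum.inl (r * s)))
        (FreeAlgebra.ι k (Sum.inl r) * FreeAlgebra.ι k (Sum.inl s))
  | smul (c : k) (r : LaurentPolynomial k) :
      GWARel k σ a (FreeAlgebra.ι k (Sum.inl (c • r))) (c • FreeAlgebra.ι k (Sum.inl r))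
  | one : GWARel k σ a (FreeAlgebra.ι k (Sum.inl 1)) 1
  | xr (r : LaurentPolynomial k) :
      GWARel k σ a (FreeAlgebra.ι k (Sum.inr 0) * FreeAlgebra.ι k (Sum.inl r))
        (FreeAlgebra.ι k (Sum.inl (σ r)) * FreeAlgebra.ι k (Sum.inr 0))
  | yr (r : LaurentPolynomial k) :
      GWARel k σ a (FreeAlgebra.ι k (Sum.inr 1) * FreeAlgebra.ι k (Sum.inl r))
        (FreeAlgebra.ι k (Sum.inl (σ.symm r)) * FreeAlgebra.ι k (Sum.inr 1))
  | yx : GWARel k σ a (FreeAlgebra.ι k (Sum.inr 1) * FreeAlgebra.ι k (Sum.inr 0))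
        (FreeAlgebra.ι k (Sum.inl a))
  | xy : GWARel k σ a (FreeAlgebra.ι k (Sum.inr 0) * FreeAlgebra.ι k (Sum.inr 1))
        (FreeAlgebra.ι k (Sum.inl (σ a)))

/-- The degree-one generalized Weyl algebra `k[h^{±1}](σ, a)`, presented as the quotient of
the free algebra on `k[h^{±1}] ⊕ {x, y}` by the generalized Weyl relations. -/
abbrev GWA (k : Type*) [CommRing k] (σ : LaurentPolynomial k ≃ₐ[k] LaurentPolynomial k)
    (a : LaurentPolynomial k) :=
  RingQuot (GWARel k σ a)

namespace GWA

variable {k : Type*} [CommRing k] (σ : LaurentPolynomial k ≃ₐ[k] LaurentPolynomial k)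
  (a : LaurentPolynomial k)

/-- The copy of the Laurent polynomial `p` inside the generalized Weyl algebra. -/
noncomputable def r (p : LaurentPolynomial k) : GWA k σ a :=
  RingQuot.mkAlgHom k (GWARel k σ a) (FreeAlgebra.ι k (Sum.inl p))

/-- The element `h` of the generalized Weyl algebra. -/
noncomputable def H : GWA k σ a := r σ a (T 1)

/-- The element `h⁻¹` of the generalized Weyl algebra. -/
noncomputable def Hinv : GWA k σ a := r σ a (T (-1))

/-- The generator `x` of the generalized Weyl algebra. -/
noncomputable def x : GWA k σ a :=
  RingQuot.mkAlgHom k (GWARel k σ a) (FreeAlgebra.ι k (Sum.inr 0))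

/-- The generator `y` of the generalized Weyl algebra. -/
noncomputable def y : GWA k σ a :=
  RingQuot.mkAlgHom k (GWARel k σ a) (FreeAlgebra.ι k (Sum.inr 1))

end GWA

/-- An element `a ∈ k[h^{±1}]` is a monomial if `a = c·hⁱ` for some `c ∈ k`, `i ∈ ℤ`. -/
def LaurentPolynomial.IsMonomial {k : Type*} [CommRing k] (a : LaurentPolynomial k) : Prop :=
  ∃ (c : k) (i : ℤ), a = C c * T i

/-- `A` is isomorphic to a member of the commutative family `k[h^{±1}](id, a')`. -/
def InFamilyId (k : Type*) [Field k] (A : Type*) [Ring A] [Algebra k A] : Prop :=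
  ∃ a' : LaurentPolynomial k,
    Nonempty (A ≃ₐ[k] GWA k ((AlgEquiv.refl : LaurentPolynomial k ≃ₐ[k] LaurentPolynomial k)) a')

/-- `A` is isomorphic to a member of the quantum family `k[h^{±1}](σ_q, a')`,
where `σ_q(h) = q h` with `q ≠ 1`. -/
def InFamilyQuantum (k : Type*) [Field k] (A : Type*) [Ring A] [Algebra k A] : Prop :=
  ∃ (q : k) (σ' : LaurentPolynomial k ≃ₐ[k] LaurentPolynomial k) (a' : LaurentPolynomial k),
    q ≠ 0 ∧ q ≠ 1 ∧ σ' (T 1) = C q * T 1 ∧ Nonempty (A ≃ₐ[k] GWA k σ' a')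

/-- `A` is isomorphic to a member of the involution family `k[h^{±1}](σ_inv, a')`,
where `σ_inv(h) = q h⁻¹`. -/
def InFamilyInvolution (k : Type*) [Field k] (A : Type*) [Ring A] [Algebra k A] : Prop :=
  ∃ (q : k) (σ' : LaurentPolynomial k ≃ₐ[k] LaurentPolynomial k) (a' : LaurentPolynomial k),
    q ≠ 0 ∧ σ' (T 1) = C q * T (-1) ∧ Nonempty (A ≃ₐ[k] GWA k σ' a')

namespace LaurentPolynomial

theorem algHom_ext_T {R B : Type*} [CommSemiring R] [Semiring B] [Algebra R B]
    {f g : LaurentPolynomial R →ₐ[R] B} (h : f (T 1) = g (T 1)) : f = g := by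
  apply AddMonoidAlgebra.algHom_ext'
  · exact MonoidHom.ext_mint h
  · ext

/-- Evaluation of Laurent polynomials at a unit of a commutative algebra. -/
noncomputable def evalUnit {R B : Type*} [CommRing R] [CommRing B] [Algebra R B] (u : Bˣ) :
    LaurentPolynomial R →ₐ[R] B :=
  { eval₂ (algebraMap R B) u with
    commutes' := fun c => by
      change eval₂ (algebraMap R B) u (algebraMap R _ c) = _
      rw [← C_eq_algebraMap, eval₂_C] }

theorem evalUnit_T {R B : Type*} [CommRing R] [CommRing B] [Algebra R B] (u : Bˣ) (n : ℤ) :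
    evalUnit (R := R) u (T n) = (u ^ n : Bˣ) :=
  eval₂_T _ u n

theorem exists_eq_C_mul_T_of_isUnit {k : Type*} [Field k] {p : LaurentPolynomial k}
    (hp : IsUnit p) : ∃ (c : k) (n : ℤ), c ≠ 0 ∧ p = C c * T n := by
  obtain ⟨v, hv⟩ := hp.exists_right_inv
  obtain ⟨m, f, hf⟩ := exists_T_pow p
  obtain ⟨n, g, hg⟩ := exists_T_pow v
  have hfg : f * g = Polynomial.X ^ (m + n) := by
    apply Polynomial.toLaurent_injective
    rw [map_mul, hf, hg, Polynomial.toLaurent_X_pow, Nat.cast_add, T_add]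
    linear_combination (T m * T n : LaurentPolynomial k) * hv
  have hdvd : f ∣ Polynomial.X ^ (m + n) := Dvd.intro g hfg
  obtain ⟨i, -, hi⟩ := (dvd_prime_pow Polynomial.prime_X _).1 hdvd
  obtain ⟨w, hw⟩ := hi.symm
  obtain ⟨c, hc, hcw⟩ := Polynomial.isUnit_iff.1 w.isUnit
  refine ⟨c, i - m, hc.ne_zero, ?_⟩
  rw [T_sub, ← mul_assoc, ← Polynomial.toLaurent_C_mul_T, ← Polynomial.C_mul_X_pow_eq_monomial,
    hcw, mul_comm _ (Polynomial.X ^ i), hw, hf, mul_T_assoc, add_neg_cancel, T_zero, mul_one]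

theorem C_mul_T_inj {k : Type*} [Field k] {c d : k} {m n : ℤ} (hc : c ≠ 0)
    (h : C c * T m = C d * T n) : c = d ∧ m = n := by
  rw [← single_eq_C_mul_T, ← single_eq_C_mul_T] at h
  have h' := (Finsupp.single_eq_single_iff m n c d).1 (congrArg AddMonoidAlgebra.coeff h)
  tauto

theorem algHom_C_mul_T {k : Type*} [Field k] (f : LaurentPolynomial k →ₐ[k] LaurentPolynomial k)
    {c : k} {n : ℤ} (hc : c ≠ 0) (hf : f (T 1) = C c * T n) (d : k) (m : ℤ) :
    f (C d * T m) = C (d * c ^ m) * T (n * m) := by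
  let u : (LaurentPolynomial k)ˣ :=
    Units.map (C : k →+* LaurentPolynomial k).toMonoidHom (Units.mk0 c hc) *
      Units.map (AddMonoidAlgebra.of k ℤ) (toUnits (Multiplicative.ofAdd n))
  have hu (j : ℤ) : ((u ^ j : (LaurentPolynomial k)ˣ) : LaurentPolynomial k) =
      C (c ^ j) * T (n * j) := by
    rw [mul_zpow, ← map_zpow, ← map_zpow, ← map_zpow, ← ofAdd_zsmul, Units.val_mul, smul_eq_mul,
      mul_comm j]
    change C ((Units.mk0 c hc ^ j : kˣ) : k) * T (n * j) = _
    rw [Units.val_zpow_eq_zpow_val, Units.val_mk0]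
  have hfe : f = evalUnit u := by
    apply algHom_ext_T
    rw [evalUnit_T, hu, hf, zpow_one, mul_one]
  rw [map_mul, C_eq_algebraMap, AlgHom.commutes, ← C_eq_algebraMap, hfe, evalUnit_T, hu, map_mul,
    mul_assoc]

theorem algEquiv_T_one {k : Type*} [Field k] (σ : LaurentPolynomial k ≃ₐ[k] LaurentPolynomial k) :
    ∃ q : k, q ≠ 0 ∧ (σ (T 1) = C q * T 1 ∨ σ (T 1) = C q * T (-1)) := by
  obtain ⟨c, n, hc, hσ⟩ := exists_eq_C_mul_T_of_isUnit ((isUnit_T (R := k) 1).map σ)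
  obtain ⟨d, m, -, hτ⟩ := exists_eq_C_mul_T_of_isUnit ((isUnit_T (R := k) 1).map σ.symm)
  have h := algHom_C_mul_T (σ : LaurentPolynomial k →ₐ[k] LaurentPolynomial k) hc hσ d m
  rw [← hτ] at h
  have h1 : (C (1 : k) * T 1 : LaurentPolynomial k) = C (d * c ^ m) * T (n * m) := by
    simpa using h
  have hnm := (C_mul_T_inj one_ne_zero h1).2
  refine ⟨c, hc, ?_⟩
  rcases Int.eq_one_or_neg_one_of_mul_eq_one hnm.symm with rfl | rfl
  · exact Or.inl hσ
  · exact Or.inr hσ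

end LaurentPolynomial

namespace GWA

section Presentation

variable {k : Type*} [CommRing k] {σ : LaurentPolynomial k ≃ₐ[k] LaurentPolynomial k}
  {a : LaurentPolynomial k}

variable (σ a) in
/-- The inclusion of `k[h^{±1}]` into the generalized Weyl algebra. -/
noncomputable def rHom : LaurentPolynomial k →ₐ[k] GWA k σ a :=
  AlgHom.ofLinearMap
    { toFun := r σ a
      map_add' := fun p s => by
        simpa [r] using RingQuot.mkAlgHom_rel k (GWARel.add (σ := σ) (a := a) p s)
      map_smul' := fun c p => by
        simpa [r] using RingQuot.mkAlgHom_rel k (GWARel.smul (σ := σ) (a := a) c p) }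
    (by simpa [r] using RingQuot.mkAlgHom_rel k (GWARel.one (k := k) (σ := σ) (a := a)))
    (fun p s => by simpa [r] using RingQuot.mkAlgHom_rel k (GWARel.mul (σ := σ) (a := a) p s))

theorem x_mul_rHom (p : LaurentPolynomial k) : x σ a * rHom σ a p = rHom σ a (σ p) * x σ a :=
  (map_mul _ _ _).symm.trans
    ((RingQuot.mkAlgHom_rel k (GWARel.xr (σ := σ) (a := a) p)).trans (map_mul _ _ _))

theorem y_mul_rHom (p : LaurentPolynomial k) :
    y σ a * rHom σ a p = rHom σ a (σ.symm p) * y σ a :=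
  (map_mul _ _ _).symm.trans
    ((RingQuot.mkAlgHom_rel k (GWARel.yr (σ := σ) (a := a) p)).trans (map_mul _ _ _))

theorem y_mul_x : y σ a * x σ a = rHom σ a a :=
  (map_mul _ _ _).symm.trans (RingQuot.mkAlgHom_rel k (GWARel.yx (σ := σ) (a := a)))

theorem x_mul_y : x σ a * y σ a = rHom σ a (σ a) :=
  (map_mul _ _ _).symm.trans (RingQuot.mkAlgHom_rel k (GWARel.xy (σ := σ) (a := a)))

/-- A subalgebra containing `k[h^{±1}]`, `x` and `y` is everything. -/
theorem mem_of_generators (S : Subalgebra k (GWA k σ a)) (hr : ∀ p, rHom σ a p ∈ S)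
    (hx : x σ a ∈ S) (hy : y σ a ∈ S) (z : GWA k σ a) : z ∈ S := by
  obtain ⟨w, rfl⟩ := RingQuot.mkAlgHom_surjective k (GWARel k σ a) z
  induction w using FreeAlgebra.induction with
  | grade0 c => simp
  | grade1 i =>
    rcases i with p | i
    · exact hr p
    · fin_cases i
      · exact hx
      · exact hy
  | mul u v hu hv => simpa using S.mul_mem hu hv
  | add u v hu hv => simpa using S.add_mem hu hv

theorem exists_lift {B : Type*} [Ring B] [Algebra k B] (ρ : LaurentPolynomial k →ₐ[k] B) (X Y : B)
    (hxr : ∀ p, X * ρ p = ρ (σ p) * X) (hyr : ∀ p, Y * ρ p = ρ (σ.symm p) * Y)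
    (hyx : Y * X = ρ a) (hxy : X * Y = ρ (σ a)) :
    ∃ f : GWA k σ a →ₐ[k] B, (∀ p, f (rHom σ a p) = ρ p) ∧ f (x σ a) = X ∧ f (y σ a) = Y := by
  let F : FreeAlgebra k (LaurentPolynomial k ⊕ Fin 2) →ₐ[k] B :=
    FreeAlgebra.lift k (Sum.elim ρ ![X, Y])
  have hF : ∀ ⦃u v⦄, GWARel k σ a u v → F u = F v := by
    rintro u v (_ | _ | _ | _ | _ | _ | _ | _) <;> simp [F, hxr, hyr, hyx, hxy]
  refine ⟨RingQuot.liftAlgHom k ⟨F, hF⟩, fun p => ?_, ?_, ?_⟩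
  · exact (RingQuot.liftAlgHom_mkAlgHom_apply k F hF _).trans (by simp [F])
  · exact (RingQuot.liftAlgHom_mkAlgHom_apply k F hF _).trans (by simp [F])
  · exact (RingQuot.liftAlgHom_mkAlgHom_apply k F hF _).trans (by simp [F])

theorem commute_of_refl (z w : GWA k (AlgEquiv.refl : _ ≃ₐ[k] LaurentPolynomial k) a) :
    Commute z w := by
  have key (u : GWA k (AlgEquiv.refl : _ ≃ₐ[k] LaurentPolynomial k) a)
      (hr : ∀ p, Commute u (rHom _ _ p)) (hx : Commute u (x _ _)) (hy : Commute u (y _ _)) (v) :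
      Commute u v := by
    have := mem_of_generators (Subalgebra.centralizer k {u})
      (fun p => by simpa [Subalgebra.mem_centralizer_iff, commute_iff_eq] using hr p)
      (by simpa [Subalgebra.mem_centralizer_iff, commute_iff_eq] using hx)
      (by simpa [Subalgebra.mem_centralizer_iff, commute_iff_eq] using hy) v
    simpa [Subalgebra.mem_centralizer_iff, commute_iff_eq] using this
  have hxr (p) : Commute (x _ _) (rHom (AlgEquiv.refl : _ ≃ₐ[k] LaurentPolynomial k) a p) :=
    x_mul_rHom p
  have hyr (p) : Commute (y _ _) (rHom (AlgEquiv.refl : _ ≃ₐ[k] LaurentPolynomial k) a p) :=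
    y_mul_rHom p
  have hxy : Commute (x _ _) (y (AlgEquiv.refl : _ ≃ₐ[k] LaurentPolynomial k) a) :=
    x_mul_y.trans y_mul_x.symm
  refine key z (fun p => ?_) ?_ ?_ w <;> apply Commute.symm <;> apply key
  · exact fun s => (Commute.all p s).map (rHom _ _)
  · exact (hxr p).symm
  · exact (hyr p).symm
  · exact hxr
  · rfl
  · exact hxy
  · exact hyr
  · exact hxy.symm
  · rfl

theorem commute_of_algEquiv {A : Type*} [Ring A] [Algebra k A]
    (e : A ≃ₐ[k] GWA k (AlgEquiv.refl : _ ≃ₐ[k] LaurentPolynomial k) a) (z w : A) :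
    Commute z w := by
  apply e.injective
  rw [map_mul, map_mul]
  exact commute_of_refl _ _

/-- The generalized Weyl algebra acts on `k[h^{±1}]`, with `x` acting as `σ`; hence it is
commutative only if `σ` is trivial. -/
theorem apply_T_one_of_commute (h : ∀ z w : GWA k σ a, Commute z w) : σ (T 1) = T 1 := by
  obtain ⟨f, hf, hfx, -⟩ := exists_lift (σ := σ) (a := a)
    (Algebra.lmul k (LaurentPolynomial k)) σ.toLinearMap
    (Algebra.lmul k (LaurentPolynomial k) a * σ.symm.toLinearMap)
    (fun p => by ext; simp) (fun p => by ext; simp [mul_left_comm])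
    (by ext; simp) (by ext; simp)
  have := congrArg f (h (x σ a) (rHom σ a (T 1)))
  rw [map_mul, map_mul, hf, hfx] at this
  simpa using LinearMap.congr_fun this 1

/-- Every commutative quotient of a quantum algebra is a quotient of `k[h^{±1}]`. -/
theorem mem_range_of_quantum {k : Type*} [Field k]
    {σ : LaurentPolynomial k ≃ₐ[k] LaurentPolynomial k} {a : LaurentPolynomial k}
    {q : k} (hq : q ≠ 0) (hq1 : q ≠ 1) (hσ : σ (T 1) = C q * T 1)
    {D : Type*} [CommRing D] [Algebra k D] (g : GWA k σ a →ₐ[k] D) (z : GWA k σ a) :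
    g z ∈ (g.comp (rHom σ a)).range := by
  have hσ' : σ.symm (T 1) = C q⁻¹ * T 1 := by
    rw [σ.symm_apply_eq, map_mul, hσ, C_eq_algebraMap, AlgEquiv.commutes, ← C_eq_algebraMap,
      ← mul_assoc, ← map_mul, inv_mul_cancel₀ hq, map_one, one_mul]
  have vanish (c : k) (hc : c ≠ 1) (w : D)
      (h : w * g (rHom σ a (T 1)) = g (rHom σ a (C c * T 1)) * w) : w = 0 := by
    have hu : IsUnit (g (rHom σ a (T 1))) := ((isUnit_T 1).map (rHom σ a)).map g
    have hc' : IsUnit (algebraMap k D (1 - c)) := (sub_ne_zero.2 hc.symm).isUnit.map _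
    rw [map_mul, map_mul, C_eq_algebraMap, AlgHom.commutes, AlgHom.commutes] at h
    rw [← hc'.mul_right_eq_zero, ← hu.mul_right_eq_zero, map_sub, map_one]
    linear_combination h
  refine mem_of_generators ((g.comp (rHom σ a)).range.comap g) (fun p => ⟨p, rfl⟩) ?_ ?_ z
  · rw [Subalgebra.mem_comap, vanish q hq1 (g (x σ a))]
    · exact zero_mem _
    · rw [← map_mul, x_mul_rHom, hσ, map_mul]
  · rw [Subalgebra.mem_comap, vanish q⁻¹ (by simpa using hq1) (g (y σ a))]
    · exact zero_mem _
    · rw [← map_mul, y_mul_rHom, hσ', map_mul]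

end Presentation

section Involution

variable {k : Type*} [Field k]

/-- The commutative algebra `k[√q][X^{±1}]` is the target of a homomorphism from the
involution algebra `k[h^{±1}](σ, a)`, `σ(h) = q h⁻¹`, sending `h` to `√q` and `x` to `X`. -/
theorem exists_algHom_of_involution {σ : LaurentPolynomial k ≃ₐ[k] LaurentPolynomial k}
    {a : LaurentPolynomial k} {q : k} (hq : q ≠ 0) (hσ : σ (T 1) = C q * T (-1)) :
    ∃ f : GWA k σ a →ₐ[k] LaurentPolynomial (QuadraticAlgebra k q 0),
      f (rHom σ a (T 1)) = C QuadraticAlgebra.omega ∧ f (x σ a) = T 1 := by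
  have hω : (QuadraticAlgebra.omega : QuadraticAlgebra k q 0) * (q⁻¹ • QuadraticAlgebra.omega)
      = 1 := by
    ext <;> simp [hq, QuadraticAlgebra.re_one, QuadraticAlgebra.im_one]
  let u : (QuadraticAlgebra k q 0)ˣ := ⟨_, _, hω, by rw [mul_comm, hω]⟩
  let ρ : LaurentPolynomial k →ₐ[k] LaurentPolynomial (QuadraticAlgebra k q 0) :=
    (IsScalarTower.toAlgHom k (QuadraticAlgebra k q 0) _).comp (evalUnit u)
  have hρ1 : ρ (T 1) = C QuadraticAlgebra.omega := by
    rw [AlgHom.comp_apply, evalUnit_T, zpow_one, C_eq_algebraMap]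
    rfl
  have hρσ (p) : ρ (σ p) = ρ p := by
    refine DFunLike.congr_fun (f := ρ.comp (σ : LaurentPolynomial k →ₐ[k] LaurentPolynomial k))
      (g := ρ) (algHom_ext_T ?_) p
    have hinv : evalUnit u (C q * T (-1)) = (u : QuadraticAlgebra k q 0) := by
      rw [map_mul, evalUnit_T, zpow_neg_one, C_eq_algebraMap, AlgHom.commutes]
      ext <;> simp [u, hq]
    change ρ (σ (T 1)) = ρ (T 1)
    rw [hσ, AlgHom.comp_apply, AlgHom.comp_apply, hinv, evalUnit_T, zpow_one]
  have hρσ' (p) : ρ (σ.symm p) = ρ p := by rw [← hρσ, σ.apply_symm_apply]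
  have hT : (T 1 * T (-1) : LaurentPolynomial (QuadraticAlgebra k q 0)) = 1 := by
    rw [← T_add, add_neg_cancel, T_zero]
  obtain ⟨f, hf, hfx, -⟩ := exists_lift (σ := σ) (a := a) ρ (T 1) (ρ a * T (-1))
    (fun p => by rw [hρσ, mul_comm]) (fun p => by rw [hρσ', mul_comm])
    (by linear_combination ρ a * hT) (by rw [hρσ]; linear_combination ρ a * hT)
  exact ⟨f, (hf _).trans hρ1, hfx⟩

theorem not_isIntegral_T_one {L : Type*} [CommRing L] [Nontrivial L] [Algebra k L] :
    ¬ IsIntegral k (T 1 : LaurentPolynomial L) := by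
  rintro ⟨p, hp, h⟩
  have hev : (Polynomial.aeval (T 1) : Polynomial k →ₐ[k] LaurentPolynomial L) p =
      Polynomial.toLaurent (p.map (algebraMap k L)) := by
    rw [← Polynomial.aeval_map_algebraMap L, ← Polynomial.toLaurentAlg_apply]
    exact DFunLike.congr_fun (Polynomial.algHom_ext (by simp)) _
  have := hev.symm.trans h
  rw [Polynomial.toLaurent_eq_zero] at this
  exact (hp.map (algebraMap k L)).ne_zero this

theorem isIntegral_map_T_one {D : Type*} [CommRing D] [Algebra k D]
    (φ : LaurentPolynomial k →ₐ[k] D) {p : LaurentPolynomial k} (hp : p ≠ 0) (h : φ p = 0) :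
    IsIntegral k (φ (T 1)) := by
  obtain ⟨n, f, hf⟩ := exists_T_pow p
  refine isAlgebraic_iff_isIntegral.1 ⟨f, ?_, ?_⟩
  · rw [← Polynomial.toLaurent_ne_zero, hf]
    exact fun h0 => hp ((isUnit_T n).mul_left_eq_zero.1 h0)
  · have hev : Polynomial.aeval (φ (T 1)) = φ.comp Polynomial.toLaurentAlg := by
      ext; simp
    rw [hev, AlgHom.comp_apply, Polynomial.toLaurentAlg_apply, hf, map_mul, h, zero_mul]

theorem injective_of_not_isIntegral {D : Type*} [CommRing D] [Algebra k D]
    (φ : LaurentPolynomial k →ₐ[k] D) {s : LaurentPolynomial k} (hs : ¬ IsIntegral k (φ s)) :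
    Function.Injective φ := by
  rw [injective_iff_map_eq_zero]
  intro p hp
  by_contra hp0
  refine hs ?_
  clear hs
  have h1 := isIntegral_map_T_one φ hp0 hp
  have h2 := isIntegral_map_T_one (φ.comp (invert : _ ≃ₐ[k] LaurentPolynomial k).toAlgHom)
    (p := invert p) (by simpa using hp0)
    (by simpa [involutive_invert p] using hp)
  replace h2 : IsIntegral k (φ (T (-1))) := by simpa using h2
  induction s using LaurentPolynomial.induction_on' with
  | add p q hp hq => exact map_add φ p q ▸ hp.add hq
  | C_mul_T n c =>
    rw [map_mul, C_eq_algebraMap, AlgHom.commutes]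
    refine isIntegral_algebraMap.mul ?_
    obtain ⟨m, rfl | rfl⟩ := n.eq_nat_or_neg
    · rw [show (m : ℤ) = m * 1 by ring, ← T_pow, map_pow]
      exact h1.pow m
    · rw [show (-m : ℤ) = m * -1 by ring, ← T_pow, map_pow]
      exact h2.pow m

theorem mem_range_C_of_sq {q : k} (hq : q ≠ 0) {u : LaurentPolynomial k} (hu : u * u = C q) :
    ∃ c, u = C c := by
  have hu' : IsUnit u := isUnit_of_mul_isUnit_left (hu ▸ hq.isUnit.map C)
  obtain ⟨c, n, hc, rfl⟩ := exists_eq_C_mul_T_of_isUnit hu'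
  have : C (c * c) * T (n + n) = C q * T 0 := by
    rw [T_zero, mul_one, ← hu, map_mul, T_add]; ring
  obtain rfl : n = 0 := by have := (C_mul_T_inj (mul_ne_zero hc hc) this).2; omega
  exact ⟨c, by simp⟩

theorem false_of_mem_range {q : k} (hq : q ≠ 0)
    (φ : LaurentPolynomial k →ₐ[k] LaurentPolynomial (QuadraticAlgebra k q 0))
    (hω : C QuadraticAlgebra.omega ∈ φ.range) (hX : T 1 ∈ φ.range) : False := by
  obtain ⟨s, hs⟩ := hX
  obtain ⟨u, hu⟩ := hω
  have hφ := injective_of_not_isIntegral φ (s := s) (by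
    rw [show φ s = T 1 from hs]; exact not_isIntegral_T_one)
  replace hu : φ u = C QuadraticAlgebra.omega := hu
  obtain ⟨c, rfl⟩ := mem_range_C_of_sq hq (u := u) (hφ (by
    rw [map_mul, hu, ← map_mul, C_eq_algebraMap q, AlgHom.commutes,
      IsScalarTower.algebraMap_apply k (QuadraticAlgebra k q 0), ← C_eq_algebraMap]
    congr 1
    ext <;> simp))
  rw [C_eq_algebraMap, AlgHom.commutes, IsScalarTower.algebraMap_apply k (QuadraticAlgebra k q 0),
    ← C_eq_algebraMap] at hu
  have := congrArg QuadraticAlgebra.im (congrArg (fun p => p.coeff 0) hu)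
  simp [← single_eq_C, -single_eq_C_mul_T] at this

end Involution

end GWA

/-- Every generalized Weyl algebra `k[h^{±1}](σ, a)` is isomorphic to a member
of one, and only one, of the three canonical families: the commutative family
`k[h^{±1}](id, a')`, the quantum family `k[h^{±1}](σ_q, a')` with `σ_q(h) = q h`, `q ≠ 1`, and
the involution family `k[h^{±1}](σ_inv, a')` with `σ_inv(h) = q h⁻¹`. -/
theorem gwa_canonical_forms (k : Type*) [Field k]
    (σ : LaurentPolynomial k ≃ₐ[k] LaurentPolynomial k) (a : LaurentPolynomial k) :
    (InFamilyId k (GWA k σ a) ∨ InFamilyQuantum k (GWA k σ a) ∨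
        InFamilyInvolution k (GWA k σ a)) ∧
      ¬(InFamilyId k (GWA k σ a) ∧ InFamilyQuantum k (GWA k σ a)) ∧
      ¬(InFamilyId k (GWA k σ a) ∧ InFamilyInvolution k (GWA k σ a)) ∧
      ¬(InFamilyQuantum k (GWA k σ a) ∧ InFamilyInvolution k (GWA k σ a)) := by
  refine ⟨?_, ?_, ?_, ?_⟩
  · obtain ⟨q, hq, h | h⟩ := algEquiv_T_one σ
    · by_cases hq1 : q = 1
      · refine Or.inl ⟨a, ?_⟩
        have hσ : σ = AlgEquiv.refl := by
          apply AlgEquiv.coe_toAlgHom_injective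
          apply algHom_ext_T
          simpa [hq1] using h
        rw [hσ]
        exact ⟨AlgEquiv.refl⟩
      · exact Or.inr (Or.inl ⟨q, σ, a, hq, hq1, h, ⟨AlgEquiv.refl⟩⟩)
    · exact Or.inr (Or.inr ⟨q, σ, a, hq, h, ⟨AlgEquiv.refl⟩⟩)
  · rintro ⟨⟨b, ⟨e⟩⟩, ⟨q, τ, c, hq, hq1, hτ, ⟨e'⟩⟩⟩
    have h : C (1 : k) * T 1 = C q * T 1 := by
      rw [← hτ, GWA.apply_T_one_of_commute (GWA.commute_of_algEquiv (e'.symm.trans e)), map_one,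
        one_mul]
    exact hq1 (C_mul_T_inj one_ne_zero h).1.symm
  · rintro ⟨⟨b, ⟨e⟩⟩, ⟨q, τ, c, hq, hτ, ⟨e'⟩⟩⟩
    have h : C (1 : k) * T 1 = C q * T (-1) := by
      rw [← hτ, GWA.apply_T_one_of_commute (GWA.commute_of_algEquiv (e'.symm.trans e)), map_one,
        one_mul]
    exact absurd (C_mul_T_inj one_ne_zero h).2 (by norm_num)
  · rintro ⟨⟨q, τ, c, hq, hq1, hτ, ⟨e⟩⟩, ⟨q', τ', c', hq', hτ', ⟨e'⟩⟩⟩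
    obtain ⟨f, hf, hfx⟩ := GWA.exists_algHom_of_involution (a := c') hq' hτ'
    let E := e.symm.trans e'
    have hmem (z) : f z ∈ ((f.comp E.toAlgHom).comp (GWA.rHom τ c)).range := by
      simpa [E] using GWA.mem_range_of_quantum hq hq1 hτ (f.comp E.toAlgHom) (E.symm z)
    exact GWA.false_of_mem_range hq' _ (hf ▸ hmem _) (hfx ▸ hmem _)
end

section
/- Let k be a field, q ∈ k^* not a root of unity, and n ≥ 1. Then the n×n matrix M over k with entries M_{ij} = q^{ij} − 1 for 1 ≤ i, j ≤ n is invertible; equivalently, the only vector x ∈ k^n with Mx = 0 is x = 0. -/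
/-- If no positive power of a nonzero `q` equals `1`, the powers of `q` are distinct. -/
theorem pow_injective_of_forall_pow_ne_one {k : Type*} [Field k] {q : k} (hq0 : q ≠ 0)
    (hq : ∀ m : ℕ, 0 < m → q ^ m ≠ 1) : Function.Injective fun m : ℕ => q ^ m := by
  intro a b hab
  wlog h : a ≤ b generalizing a b
  · exact (this hab.symm (le_of_not_ge h)).symm
  obtain ⟨c, rfl⟩ := Nat.exists_eq_add_of_le h
  have hc : q ^ c = 1 := by
    have hab' : q ^ a * q ^ c = q ^ a * 1 := by simpa [pow_add] using hab.symm
    exact mul_left_cancel₀ (pow_ne_zero a hq0) hab'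
  rcases Nat.eq_zero_or_pos c with rfl | hpos
  · simp
  · exact absurd hc (hq c hpos)

/-- If `q` is not a root of unity, the `n × n` matrix with entries
`q^(i*j) - 1` (for `1 ≤ i, j ≤ n`) is invertible; equivalently its kernel is trivial. -/
theorem matrix_qij_sub_one_invertible (k : Type*) [Field k] (q : k) (hq0 : q ≠ 0)
    (hq : ∀ m : ℕ, 0 < m → q ^ m ≠ 1) (n : ℕ) (hn : 1 ≤ n) :
    IsUnit (Matrix.of (fun i j : Fin n => q ^ (((i : ℕ) + 1) * ((j : ℕ) + 1)) - 1)) ∧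
      ∀ x : Fin n → k,
        (Matrix.of (fun i j : Fin n => q ^ (((i : ℕ) + 1) * ((j : ℕ) + 1)) - 1)).mulVec x = 0 →
          x = 0 := by
  have hker : ∀ x : Fin n → k,
      (Matrix.of (fun i j : Fin n => q ^ (((i : ℕ) + 1) * ((j : ℕ) + 1)) - 1)).mulVec x = 0 →
        x = 0 := by
    intro x hx
    have hv : Function.Injective fun j : Fin (n + 1) => q ^ (j : ℕ) :=
      (pow_injective_of_forall_pow_ne_one hq0 hq).comp Fin.val_injective
    -- Extending `x` by `-∑ x` yields a vector killed by the Vandermonde matrix of `1, q, …, q ^ n`.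
    have hf : (Fin.cons (-∑ j, x j) x : Fin (n + 1) → k) = 0 := by
      refine Matrix.eq_zero_of_forall_pow_sum_mul_pow_eq_zero hv fun i => ?_
      rw [Fin.sum_univ_succ]
      refine Fin.cases ?_ (fun i => ?_) i
      · simp
      · have hi := congrFun hx i
        simp only [Matrix.mulVec, dotProduct, Matrix.of_apply, sub_mul, one_mul,
          Finset.sum_sub_distrib, Pi.zero_apply] at hi
        simp only [Fin.cons_zero, Fin.cons_succ, Fin.val_zero, Fin.val_succ, pow_zero, one_pow,
          mul_one, ← pow_mul]
        rw [← hi, neg_add_eq_sub]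
        congr 1
        exact Finset.sum_congr rfl fun j _ => by rw [mul_comm, mul_comm ((j : ℕ) + 1)]
    funext j
    simpa using congrFun hf j.succ
  refine ⟨?_, hker⟩
  rw [← Matrix.mulVec_injective_iff_isUnit]
  intro x y hxy
  exact sub_eq_zero.mp (hker _ (by rw [Matrix.mulVec_sub, sub_eq_zero]; exact hxy))
end

section
/- Let k be a field and q ∈ k^*. A Laurent polynomial p ∈ k[h^{±1}] satisfies p(h) = p(q h^{-1}) (where p(q h^{-1}) denotes the image of p under the k-algebra automorphism of k[h^{±1}] sending h to q h^{-1}) if and only if p lies in the k-subalgebra of k[h^{±1}] generated by h + q h^{-1}. -/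
open LaurentPolynomial

/-- Every Laurent polynomial is an `R`-linear combination of `1` and `T 1`, where `R` is the
subalgebra generated by `T 1 + C q * T (-1)`. -/
lemma LaurentPolynomial.exists_eq_add_mul_T_of_adjoin {k : Type*} [Field k] {q : k} (hq : q ≠ 0)
    (p : LaurentPolynomial k) :
    ∃ a ∈ Algebra.adjoin k ({T 1 + C q * T (-1)} : Set (LaurentPolynomial k)),
    ∃ b ∈ Algebra.adjoin k ({T 1 + C q * T (-1)} : Set (LaurentPolynomial k)),
      p = a + b * T 1 := by
  set x : LaurentPolynomial k := T 1 + C q * T (-1) with hx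
  set S := Algebra.adjoin k ({x} : Set (LaurentPolynomial k))
  have hxS : x ∈ S := Algebra.self_mem_adjoin_singleton k x
  have hC (c : k) : C c ∈ S := by
    rw [C_eq_algebraMap]
    exact S.algebraMap_mem c
  have hT : (T 1 * T (-1) : LaurentPolynomial k) = 1 := by
    rw [← T_add, add_neg_cancel, T_zero]
  have hqC : (C q * C q⁻¹ : LaurentPolynomial k) = 1 := by
    rw [← map_mul, mul_inv_cancel₀ hq, map_one]
  induction p using LaurentPolynomial.induction_on with
  | h_C c => exact ⟨C c, hC c, 0, S.zero_mem, by simp⟩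
  | h_add hp hp' =>
    obtain ⟨a, ha, b, hb, rfl⟩ := hp
    obtain ⟨a', ha', b', hb', rfl⟩ := hp'
    exact ⟨a + a', S.add_mem ha ha', b + b', S.add_mem hb hb', by ring⟩
  | h_C_mul_T n c hp =>
    obtain ⟨a, ha, b, hb, h⟩ := hp
    refine ⟨-(C q * b), S.neg_mem (S.mul_mem (hC q) hb), a + x * b,
      S.add_mem ha (S.mul_mem hxS hb), ?_⟩
    rw [T_add, ← mul_assoc, h, hx]
    linear_combination -C q * b * hT
  | h_C_mul_T_Z n c hp =>
    obtain ⟨a, ha, b, hb, h⟩ := hp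
    refine ⟨b + C q⁻¹ * (x * a), S.add_mem hb (S.mul_mem (hC _) (S.mul_mem hxS ha)),
      -(C q⁻¹ * a), S.neg_mem (S.mul_mem (hC _) ha), ?_⟩
    rw [sub_eq_add_neg, T_add, ← mul_assoc, h, hx]
    linear_combination b * hT - a * T (-1) * hqC

/-- A Laurent polynomial `p` satisfies `p(h) = p(q h⁻¹)` (where `σ` is the
`k`-algebra automorphism of `k[h^{±1}]` with `h ↦ q h⁻¹`) if and only if `p` lies in the
`k`-subalgebra generated by `h + q h⁻¹`. -/
theorem laurent_fixed_iff_mem_adjoin (k : Type*) [Field k] (q : k) (hq : q ≠ 0)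
    (σ : LaurentPolynomial k ≃ₐ[k] LaurentPolynomial k)
    (hσ : σ (T 1) = C q * T (-1)) (p : LaurentPolynomial k) :
    p = σ p ↔ p ∈ Algebra.adjoin k ({T 1 + C q * T (-1)} : Set (LaurentPolynomial k)) := by
  have hT : (T 1 * T (-1) : LaurentPolynomial k) = 1 := by
    rw [← T_add, add_neg_cancel, T_zero]
  have hσC : σ (C q) = C q := by rw [C_eq_algebraMap, σ.commutes]
  have hσT : C q * σ (T (-1)) = T 1 := by
    have h : σ (T 1) * σ (T (-1)) = 1 := by rw [← map_mul, hT, map_one]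
    rw [hσ] at h
    linear_combination T 1 * h - C q * σ (T (-1)) * hT
  have hfix {a : LaurentPolynomial k}
      (ha : a ∈ Algebra.adjoin k ({T 1 + C q * T (-1)} : Set (LaurentPolynomial k))) :
      σ a = a := by
    have hle : Algebra.adjoin k ({T 1 + C q * T (-1)} : Set (LaurentPolynomial k)) ≤
        AlgHom.equalizer (σ : LaurentPolynomial k →ₐ[k] LaurentPolynomial k) (AlgHom.id k _) := by
      rw [Algebra.adjoin_le_iff, Set.singleton_subset_iff]
      change σ (T 1 + C q * T (-1)) = T 1 + C q * T (-1)
      rw [map_add, map_mul, hσ, hσC, hσT, add_comm]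
    exact hle ha
  refine ⟨fun hp ↦ ?_, fun hp ↦ (hfix hp).symm⟩
  obtain ⟨a, ha, b, hb, rfl⟩ := exists_eq_add_mul_T_of_adjoin hq p
  rw [map_add, map_mul, hfix ha, hfix hb, hσ] at hp
  have hne : (T 1 - C q * T (-1) : LaurentPolynomial k) ≠ 0 := by
    rw [← single_eq_C_mul_T]
    intro h
    have h1 := congrArg (fun f : LaurentPolynomial k ↦ f.coeff 1) h
    simp only [AddMonoidAlgebra.coeff_sub, Finsupp.sub_apply, T_apply,
      AddMonoidAlgebra.coeff_single, Finsupp.single_apply, AddMonoidAlgebra.coeff_zero] at h1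
    norm_num at h1
  have hb0 : b = 0 :=
    (mul_eq_zero.mp (show b * (T 1 - C q * T (-1)) = 0 by linear_combination hp)).resolve_right hne
  simpa [hb0] using ha
end
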